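/- arXiv:1511.05278 — 2 statements merged into one kernel-verified Lean document; each statement's English description precedes it below -/
import Mathlib

section
/- For every ν ∈ {0, 1, ..., 12} and every v ∈ ℂ⁶, 13² · 𝔾₀((S·Tᵛ)·v) = −13·𝔾₀(v) + Σ_{j=1}^{12} ζ^{jν}·𝔾_j(v), where (S·Tᵛ)·v denotes the matrix S·Tᵛ applied to the column vector v. -/
noncomputable section

open Complex

def ζ : ℂ := Complex.exp (2 * Real.pi * Complex.I / 13)

def Tmat : Matrix (Fin 6) (Fin 6) ℂ :=
  Matrix.diagonal ![ζ ^ 7, ζ ^ 11, ζ ^ 8, ζ ^ 6, ζ ^ 2, ζ ^ 5]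

def Smat : Matrix (Fin 6) (Fin 6) ℂ :=
  (-(1 / (Real.sqrt 13 : ℂ))) •
    !![ζ ^ 12 - ζ, ζ ^ 10 - ζ ^ 3, ζ ^ 4 - ζ ^ 9, ζ ^ 5 - ζ ^ 8, ζ ^ 2 - ζ ^ 11, ζ ^ 6 - ζ ^ 7;
       ζ ^ 10 - ζ ^ 3, ζ ^ 4 - ζ ^ 9, ζ ^ 12 - ζ, ζ ^ 2 - ζ ^ 11, ζ ^ 6 - ζ ^ 7, ζ ^ 5 - ζ ^ 8;
       ζ ^ 4 - ζ ^ 9, ζ ^ 12 - ζ, ζ ^ 10 - ζ ^ 3, ζ ^ 6 - ζ ^ 7, ζ ^ 5 - ζ ^ 8, ζ ^ 2 - ζ ^ 11;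
       ζ ^ 5 - ζ ^ 8, ζ ^ 2 - ζ ^ 11, ζ ^ 6 - ζ ^ 7, ζ - ζ ^ 12, ζ ^ 3 - ζ ^ 10, ζ ^ 9 - ζ ^ 4;
       ζ ^ 2 - ζ ^ 11, ζ ^ 6 - ζ ^ 7, ζ ^ 5 - ζ ^ 8, ζ ^ 3 - ζ ^ 10, ζ ^ 9 - ζ ^ 4, ζ - ζ ^ 12;
       ζ ^ 6 - ζ ^ 7, ζ ^ 5 - ζ ^ 8, ζ ^ 2 - ζ ^ 11, ζ ^ 9 - ζ ^ 4, ζ - ζ ^ 12, ζ ^ 3 - ζ ^ 10]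

def DD0 (v : Fin 6 → ℂ) : ℂ := v 0 * v 1 * v 2
def DD1 (v : Fin 6 → ℂ) : ℂ := 2 * v 1 * (v 2) ^ 2 + (v 1) ^ 2 * v 5 - (v 3) ^ 2 * v 4 + v 0 * v 4 * v 5
def DD2 (v : Fin 6 → ℂ) : ℂ := -(v 5) ^ 3 + (v 1) ^ 2 * v 3 - 2 * v 1 * (v 4) ^ 2 + v 0 * v 3 * v 4 + 3 * v 2 * v 4 * v 5
def DD3 (v : Fin 6 → ℂ) : ℂ := 2 * v 0 * (v 1) ^ 2 + (v 0) ^ 2 * v 4 - v 3 * (v 5) ^ 2 + v 2 * v 3 * v 4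
def DD4 (v : Fin 6 → ℂ) : ℂ := -(v 1) ^ 2 * v 2 + v 0 * (v 5) ^ 2 - 2 * (v 3) ^ 2 * v 5 - v 0 * v 2 * v 4
def DD5 (v : Fin 6 → ℂ) : ℂ := -(v 3) ^ 3 + (v 2) ^ 2 * v 4 - 2 * v 2 * (v 5) ^ 2 + v 1 * v 4 * v 5 + 3 * v 0 * v 3 * v 5
def DD6 (v : Fin 6 → ℂ) : ℂ := -(v 4) ^ 3 + (v 0) ^ 2 * v 5 - 2 * v 0 * (v 3) ^ 2 + v 2 * v 3 * v 5 + 3 * v 1 * v 3 * v 4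
def DD7 (v : Fin 6 → ℂ) : ℂ := -(v 1) ^ 3 + v 2 * (v 3) ^ 2 - v 0 * v 2 * v 5 - 3 * v 0 * v 1 * v 4 + 2 * (v 0) ^ 2 * v 3
def DD8 (v : Fin 6 → ℂ) : ℂ := -(v 0) ^ 3 + v 1 * (v 5) ^ 2 - v 1 * v 2 * v 4 - 3 * v 0 * v 2 * v 3 + 2 * (v 2) ^ 2 * v 5
def DD9 (v : Fin 6 → ℂ) : ℂ := 2 * (v 0) ^ 2 * v 2 + (v 2) ^ 2 * v 3 - (v 4) ^ 2 * v 5 + v 1 * v 3 * v 5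
def DD10 (v : Fin 6 → ℂ) : ℂ := -(v 0) * (v 2) ^ 2 + v 1 * (v 3) ^ 2 - 2 * v 3 * (v 4) ^ 2 - v 0 * v 1 * v 5
def DD11 (v : Fin 6 → ℂ) : ℂ := -(v 2) ^ 3 + v 0 * (v 4) ^ 2 - v 0 * v 1 * v 3 - 3 * v 1 * v 2 * v 5 + 2 * (v 1) ^ 2 * v 4
def DD12 (v : Fin 6 → ℂ) : ℂ := -(v 0) ^ 2 * v 1 + v 2 * (v 4) ^ 2 - 2 * v 4 * (v 5) ^ 2 - v 1 * v 2 * v 3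
def DDinf (v : Fin 6 → ℂ) : ℂ := v 3 * v 4 * v 5

def GG0 (v : Fin 6 → ℂ) : ℂ := (DD0 v) ^ 2 + (DDinf v) ^ 2
def GG1 (v : Fin 6 → ℂ) : ℂ := -(DD7 v) ^ 2 + 2 * DD0 v * DD1 v + 10 * DDinf v * DD1 v + 2 * DD2 v * DD12 v - 2 * DD3 v * DD11 v - 4 * DD4 v * DD10 v - 2 * DD9 v * DD5 v
def GG2 (v : Fin 6 → ℂ) : ℂ := -2 * (DD1 v) ^ 2 - 4 * DD0 v * DD2 v + 6 * DDinf v * DD2 v - 2 * DD4 v * DD11 v + 2 * DD5 v * DD10 v - 2 * DD6 v * DD9 v - 2 * DD7 v * DD8 v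
def GG3 (v : Fin 6 → ℂ) : ℂ := -(DD8 v) ^ 2 + 2 * DD0 v * DD3 v + 10 * DDinf v * DD3 v + 2 * DD6 v * DD10 v - 2 * DD9 v * DD7 v - 4 * DD12 v * DD4 v - 2 * DD1 v * DD2 v
def GG4 (v : Fin 6 → ℂ) : ℂ := -(DD2 v) ^ 2 + 10 * DD0 v * DD4 v - 2 * DDinf v * DD4 v + 2 * DD5 v * DD12 v - 2 * DD9 v * DD8 v - 4 * DD1 v * DD3 v - 2 * DD10 v * DD7 v
def GG5 (v : Fin 6 → ℂ) : ℂ := -2 * (DD9 v) ^ 2 - 4 * DD0 v * DD5 v + 6 * DDinf v * DD5 v - 2 * DD10 v * DD8 v + 2 * DD6 v * DD12 v - 2 * DD2 v * DD3 v - 2 * DD11 v * DD7 v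
def GG6 (v : Fin 6 → ℂ) : ℂ := -2 * (DD3 v) ^ 2 - 4 * DD0 v * DD6 v + 6 * DDinf v * DD6 v - 2 * DD12 v * DD7 v + 2 * DD2 v * DD4 v - 2 * DD5 v * DD1 v - 2 * DD8 v * DD11 v
def GG7 (v : Fin 6 → ℂ) : ℂ := -2 * (DD10 v) ^ 2 + 6 * DD0 v * DD7 v + 4 * DDinf v * DD7 v - 2 * DD1 v * DD6 v - 2 * DD2 v * DD5 v - 2 * DD8 v * DD12 v - 2 * DD9 v * DD11 v
def GG8 (v : Fin 6 → ℂ) : ℂ := -2 * (DD4 v) ^ 2 + 6 * DD0 v * DD8 v + 4 * DDinf v * DD8 v - 2 * DD3 v * DD5 v - 2 * DD6 v * DD2 v - 2 * DD11 v * DD10 v - 2 * DD1 v * DD7 v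
def GG9 (v : Fin 6 → ℂ) : ℂ := -(DD11 v) ^ 2 + 2 * DD0 v * DD9 v + 10 * DDinf v * DD9 v + 2 * DD5 v * DD4 v - 2 * DD1 v * DD8 v - 4 * DD10 v * DD12 v - 2 * DD3 v * DD6 v
def GG10 (v : Fin 6 → ℂ) : ℂ := -(DD5 v) ^ 2 + 10 * DD0 v * DD10 v - 2 * DDinf v * DD10 v + 2 * DD6 v * DD4 v - 2 * DD3 v * DD7 v - 4 * DD9 v * DD1 v - 2 * DD12 v * DD11 v
def GG11 (v : Fin 6 → ℂ) : ℂ := -2 * (DD12 v) ^ 2 + 6 * DD0 v * DD11 v + 4 * DDinf v * DD11 v - 2 * DD9 v * DD2 v - 2 * DD5 v * DD6 v - 2 * DD7 v * DD4 v - 2 * DD3 v * DD8 v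
def GG12 (v : Fin 6 → ℂ) : ℂ := -(DD6 v) ^ 2 + 10 * DD0 v * DD12 v - 2 * DDinf v * DD12 v + 2 * DD2 v * DD10 v - 2 * DD1 v * DD11 v - 4 * DD3 v * DD9 v - 2 * DD4 v * DD8 v

/-- The first combination of the cubic forms occurring in the images of `DD0`, `DDinf` under `S`. -/
def evenCubic (v : Fin 6 → ℂ) : ℂ :=
  2 * DD0 v - 3 * DDinf v + (DD1 v + DD3 v + DD9 v) + (DD2 v + DD5 v + DD6 v)
    - (DD4 v + DD10 v + DD12 v)

/-- The second combination of the cubic forms occurring in the images of `DD0`, `DDinf` under `S`. -/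
def oddCubic (v : Fin 6 → ℂ) : ℂ :=
  -3 * DD0 v - 2 * DDinf v + (DD1 v + DD3 v + DD9 v) + (DD4 v + DD10 v + DD12 v)
    + (DD7 v + DD8 v + DD11 v)

lemma sum_GG_eq (v : Fin 6 → ℂ) :
    -13 * GG0 v + GG1 v + GG2 v + GG3 v + GG4 v + GG5 v + GG6 v + GG7 v + GG8 v + GG9 v
      + GG10 v + GG11 v + GG12 v = -(evenCubic v ^ 2 + oddCubic v ^ 2) := by
  simp only [GG0, GG1, GG2, GG3, GG4, GG5, GG6, GG7, GG8, GG9, GG10, GG11, GG12, evenCubic,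
    oddCubic]
  ring

lemma prod_rows_eq {x a b c d e f p q : ℂ} (hx : ∑ i ∈ Finset.range 13, x ^ i = 0)
    (ha : a = x ^ 12 - x) (hb : b = x ^ 10 - x ^ 3) (hc : c = x ^ 4 - x ^ 9)
    (hd : d = x ^ 5 - x ^ 8) (he : e = x ^ 2 - x ^ 11) (hf : f = x ^ 6 - x ^ 7)
    (hp : p = -(a + b + c)) (hq : q = d + e + f) (v : Fin 6 → ℂ) :
    (a * v 0 + b * v 1 + c * v 2 + d * v 3 + e * v 4 + f * v 5)
      * (b * v 0 + c * v 1 + a * v 2 + e * v 3 + f * v 4 + d * v 5)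
      * (c * v 0 + a * v 1 + b * v 2 + f * v 3 + d * v 4 + e * v 5)
      = p * evenCubic v + q * oddCubic v := by
  simp only [Finset.sum_range_succ, Finset.sum_range_zero, pow_zero, pow_one, zero_add] at hx
  have h1 : a * b * c = -q := by subst_vars; grind
  have h2 : a ^ 2 * b + a * c ^ 2 + b ^ 2 * c = p - q := by subst_vars; grind
  have h3 : a ^ 2 * c + a * b ^ 2 + b * c ^ 2 = 2 * p + 2 * q := by subst_vars; grind
  have h4 : a * b * f + a * c * e + b * c * d = 2 * q := by subst_vars; grind
  have h5 : a * b * d + a * c * f + b * c * e = p + q := by subst_vars; grind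
  have h6 : a * b * e + a * c * d + b * c * f = p := by subst_vars; grind
  have h7 : a ^ 3 + 3 * a * b * c + b ^ 3 + c ^ 3 = 2 * p - 3 * q := by subst_vars; grind
  have h8 : a ^ 2 * e + a * b * d + a * c * f + b ^ 2 * f + b * c * e + c ^ 2 * d = -q := by
    subst_vars; grind
  have h9 : a ^ 2 * f + a * b * e + a * c * d + b ^ 2 * d + b * c * f + c ^ 2 * e = -3 * q := by
    subst_vars; grind
  have h10 : a ^ 2 * d + a * b * f + a * c * e + b ^ 2 * e + b * c * d + c ^ 2 * f = p - q := by
    subst_vars; grind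
  have h11 : a * e * f + b * d * f + c * d * e = -2 * p := by subst_vars; grind
  have h12 : a * d * e + a * f ^ 2 + b * d ^ 2 + b * e * f + c * d * f + c * e ^ 2 = p := by
    subst_vars; grind
  have h13 : a * d * f + a * e ^ 2 + b * d * e + b * f ^ 2 + c * d ^ 2 + c * e * f = 3 * p := by
    subst_vars; grind
  have h14 : a * d * f + b * d * e + c * e * f = q := by subst_vars; grind
  have h15 : a * d ^ 2 + a * e * f + b * d * f + b * e ^ 2 + c * d * e + c * f ^ 2 = p + q := by
    subst_vars; grind
  have h16 : a * d * e + b * e * f + c * d * f = -p + q := by subst_vars; grind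
  have h17 : d * e * f = -p := by subst_vars; grind
  have h18 : d ^ 2 * e + d * f ^ 2 + e ^ 2 * f = -p - q := by subst_vars; grind
  have h19 : d ^ 2 * f + d * e ^ 2 + e * f ^ 2 = 2 * p - 2 * q := by subst_vars; grind
  have h20 : d ^ 3 + 3 * d * e * f + e ^ 3 + f ^ 3 = -3 * p - 2 * q := by subst_vars; grind
  simp only [evenCubic, oddCubic, DD0, DD1, DD2, DD3, DD4, DD5, DD6, DD7, DD8, DD9, DD10, DD11,
    DD12, DDinf]
  linear_combination (v 0 ^ 3 + v 1 ^ 3 + v 2 ^ 3) * h1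
    + (v 0 ^ 2 * v 1 + v 0 * v 2 ^ 2 + v 1 ^ 2 * v 2) * h2
    + (v 0 ^ 2 * v 2 + v 0 * v 1 ^ 2 + v 1 * v 2 ^ 2) * h3
    + (v 0 ^ 2 * v 3 + v 1 ^ 2 * v 4 + v 2 ^ 2 * v 5) * h4
    + (v 0 ^ 2 * v 4 + v 1 ^ 2 * v 5 + v 2 ^ 2 * v 3) * h5
    + (v 0 ^ 2 * v 5 + v 1 ^ 2 * v 3 + v 2 ^ 2 * v 4) * h6 + v 0 * v 1 * v 2 * h7
    + (v 0 * v 1 * v 3 + v 0 * v 2 * v 5 + v 1 * v 2 * v 4) * h8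
    + (v 0 * v 1 * v 4 + v 0 * v 2 * v 3 + v 1 * v 2 * v 5) * h9
    + (v 0 * v 1 * v 5 + v 0 * v 2 * v 4 + v 1 * v 2 * v 3) * h10
    + (v 0 * v 3 ^ 2 + v 1 * v 4 ^ 2 + v 2 * v 5 ^ 2) * h11
    + (v 0 * v 3 * v 4 + v 1 * v 4 * v 5 + v 2 * v 3 * v 5) * h12
    + (v 0 * v 3 * v 5 + v 1 * v 3 * v 4 + v 2 * v 4 * v 5) * h13
    + (v 0 * v 4 ^ 2 + v 1 * v 5 ^ 2 + v 2 * v 3 ^ 2) * h14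
    + (v 0 * v 4 * v 5 + v 1 * v 3 * v 5 + v 2 * v 3 * v 4) * h15
    + (v 0 * v 5 ^ 2 + v 1 * v 3 ^ 2 + v 2 * v 4 ^ 2) * h16 + (v 3 ^ 3 + v 4 ^ 3 + v 5 ^ 3) * h17
    + (v 3 ^ 2 * v 4 + v 3 * v 5 ^ 2 + v 4 ^ 2 * v 5) * h18
    + (v 3 ^ 2 * v 5 + v 3 * v 4 ^ 2 + v 4 * v 5 ^ 2) * h19 + v 3 * v 4 * v 5 * h20

lemma sq_add_sq_periods {x : ℂ} (hx : ∑ i ∈ Finset.range 13, x ^ i = 0) :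
    (-(x ^ 12 - x + (x ^ 10 - x ^ 3) + (x ^ 4 - x ^ 9))) ^ 2
      + (x ^ 5 - x ^ 8 + (x ^ 2 - x ^ 11) + (x ^ 6 - x ^ 7)) ^ 2 = -13 := by
  simp only [Finset.sum_range_succ, Finset.sum_range_zero, pow_zero, pow_one, zero_add] at hx
  grind

lemma isPrimitiveRoot_ζ : IsPrimitiveRoot ζ 13 := by
  simpa [ζ] using Complex.isPrimitiveRoot_exp 13 (by norm_num)

lemma DD0_smul (r : ℂ) (v : Fin 6 → ℂ) : DD0 (r • v) = r ^ 3 * DD0 v := by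
  simp only [DD0, Pi.smul_apply, smul_eq_mul]
  ring

lemma DDinf_smul (r : ℂ) (v : Fin 6 → ℂ) : DDinf (r • v) = r ^ 3 * DDinf v := by
  simp only [DDinf, Pi.smul_apply, smul_eq_mul]
  ring

lemma GG0_mulVec_Smat (w : Fin 6 → ℂ) :
    13 ^ 3 * GG0 (Smat.mulVec w) = -13 * (evenCubic w ^ 2 + oddCubic w ^ 2) := by
  have hmod (i j : ℕ) (hij : 8 * i ≡ j [MOD 13]) : (ζ ^ 8) ^ i = ζ ^ j := by
    rw [← pow_mul]
    exact pow_eq_pow_of_modEq hij isPrimitiveRoot_ζ.pow_eq_one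
  have hsum := isPrimitiveRoot_ζ.geom_sum_eq_zero (by norm_num)
  have hsum' := (isPrimitiveRoot_ζ.pow_of_coprime 8 (by norm_num)).geom_sum_eq_zero (by norm_num)
  obtain ⟨p, hp⟩ : ∃ p, p = -(ζ ^ 12 - ζ + (ζ ^ 10 - ζ ^ 3) + (ζ ^ 4 - ζ ^ 9)) := ⟨_, rfl⟩
  obtain ⟨q, hq⟩ : ∃ q, q = ζ ^ 5 - ζ ^ 8 + (ζ ^ 2 - ζ ^ 11) + (ζ ^ 6 - ζ ^ 7) := ⟨_, rfl⟩
  have h := prod_rows_eq hsum rfl rfl rfl rfl rfl rfl hp hq w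
  have h' := prod_rows_eq (a := ζ ^ 5 - ζ ^ 8) (b := ζ ^ 2 - ζ ^ 11) (c := ζ ^ 6 - ζ ^ 7)
    (d := ζ - ζ ^ 12) (e := ζ ^ 3 - ζ ^ 10) (f := ζ ^ 9 - ζ ^ 4) (p := -q) (q := p) hsum'
    (by rw [hmod 12 5 rfl]) (by rw [hmod 10 2 rfl, hmod 3 11 rfl])
    (by rw [hmod 4 6 rfl, hmod 9 7 rfl]) (by rw [hmod 5 1 rfl, hmod 8 12 rfl, pow_one])
    (by rw [hmod 2 3 rfl, hmod 11 10 rfl]) (by rw [hmod 6 9 rfl, hmod 7 4 rfl])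
    (by rw [hq]) (by rw [hp]; ring) w
  have hpq : p ^ 2 + q ^ 2 = -13 := by rw [hp, hq, sq_add_sq_periods hsum]
  have hsqrt : (Real.sqrt 13 : ℂ) ^ 2 = 13 := by
    rw [← Complex.ofReal_pow, Real.sq_sqrt (by norm_num)]
    norm_num
  have hinv : (-(1 / (Real.sqrt 13 : ℂ))) ^ 6 * 13 ^ 3 = 1 := by
    rw [← hsqrt]
    field_simp
  have hD0 : DD0 (Smat.mulVec w) =
      (-(1 / (Real.sqrt 13 : ℂ))) ^ 3 * (p * evenCubic w + q * oddCubic w) := by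
    rw [← h, Smat, Matrix.smul_mulVec, DD0_smul]
    simp only [DD0, Matrix.mulVec, dotProduct, Fin.sum_univ_six, Matrix.of_apply, Matrix.cons_val]
  have hDinf : DDinf (Smat.mulVec w) =
      (-(1 / (Real.sqrt 13 : ℂ))) ^ 3 * (-q * evenCubic w + p * oddCubic w) := by
    rw [← h', Smat, Matrix.smul_mulVec, DDinf_smul]
    simp only [DDinf, Matrix.mulVec, dotProduct, Fin.sum_univ_six, Matrix.of_apply, Matrix.cons_val]
  rw [GG0, hD0, hDinf]
  linear_combination (evenCubic w ^ 2 + oddCubic w ^ 2) * (hpq + (p ^ 2 + q ^ 2) * hinv)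

/-- `T ^ ν` multiplies each monomial in the `j`-th form by a power of `y = ζ ^ ν`. -/
def torusAct (y : ℂ) (v : Fin 6 → ℂ) : Fin 6 → ℂ :=
  ![y ^ 7 * v 0, y ^ 11 * v 1, y ^ 8 * v 2, y ^ 6 * v 3, y ^ 2 * v 4, y ^ 5 * v 5]

lemma DD_torusAct {y : ℂ} (hy : y ^ 13 = 1) (v : Fin 6 → ℂ) :
    DD0 (torusAct y v) = DD0 v ∧ DDinf (torusAct y v) = DDinf v ∧
    DD1 (torusAct y v) = y * DD1 v ∧ DD2 (torusAct y v) = y ^ 2 * DD2 v ∧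
    DD3 (torusAct y v) = y ^ 3 * DD3 v ∧ DD4 (torusAct y v) = y ^ 4 * DD4 v ∧
    DD5 (torusAct y v) = y ^ 5 * DD5 v ∧ DD6 (torusAct y v) = y ^ 6 * DD6 v ∧
    DD7 (torusAct y v) = y ^ 7 * DD7 v ∧ DD8 (torusAct y v) = y ^ 8 * DD8 v ∧
    DD9 (torusAct y v) = y ^ 9 * DD9 v ∧ DD10 (torusAct y v) = y ^ 10 * DD10 v ∧
    DD11 (torusAct y v) = y ^ 11 * DD11 v ∧ DD12 (torusAct y v) = y ^ 12 * DD12 v := by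
  refine ⟨?_, ?_, ?_, ?_, ?_, ?_, ?_, ?_, ?_, ?_, ?_, ?_, ?_, ?_⟩ <;>
    simp [torusAct, DD0, DD1, DD2, DD3, DD4, DD5, DD6, DD7, DD8, DD9, DD10, DD11, DD12, DDinf] <;>
    grind

lemma GG_torusAct {y : ℂ} (hy : y ^ 13 = 1) (v : Fin 6 → ℂ) :
    GG0 (torusAct y v) = GG0 v ∧ GG1 (torusAct y v) = y * GG1 v ∧
    GG2 (torusAct y v) = y ^ 2 * GG2 v ∧
    GG3 (torusAct y v) = y ^ 3 * GG3 v ∧ GG4 (torusAct y v) = y ^ 4 * GG4 v ∧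
    GG5 (torusAct y v) = y ^ 5 * GG5 v ∧ GG6 (torusAct y v) = y ^ 6 * GG6 v ∧
    GG7 (torusAct y v) = y ^ 7 * GG7 v ∧ GG8 (torusAct y v) = y ^ 8 * GG8 v ∧
    GG9 (torusAct y v) = y ^ 9 * GG9 v ∧ GG10 (torusAct y v) = y ^ 10 * GG10 v ∧
    GG11 (torusAct y v) = y ^ 11 * GG11 v ∧ GG12 (torusAct y v) = y ^ 12 * GG12 v := by
  obtain ⟨h0, hinf, h1, h2, h3, h4, h5, h6, h7, h8, h9, h10, h11, h12⟩ := DD_torusAct hy v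
  simp only [GG0, GG1, GG2, GG3, GG4, GG5, GG6, GG7, GG8, GG9, GG10, GG11, GG12, h0, hinf, h1, h2,
    h3, h4, h5, h6, h7, h8, h9, h10, h11, h12]
  refine ⟨?_, ?_, ?_, ?_, ?_, ?_, ?_, ?_, ?_, ?_, ?_, ?_, ?_⟩ <;> grind

lemma mulVec_Tmat_pow (ν : ℕ) (v : Fin 6 → ℂ) :
    (Tmat ^ ν).mulVec v = torusAct (ζ ^ ν) v := by
  ext i
  rw [Tmat, Matrix.diagonal_pow, Matrix.mulVec_diagonal]
  fin_cases i <;> simp [torusAct, ← pow_mul, mul_comm]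

theorem stmt3 (ν : ℕ) (hν : ν ≤ 12) (v : Fin 6 → ℂ) :
    (13 : ℂ) ^ 2 * GG0 (Matrix.mulVec (Smat * Tmat ^ ν) v) =
      -13 * GG0 v + ζ ^ ν * GG1 v + ζ ^ (2 * ν) * GG2 v + ζ ^ (3 * ν) * GG3 v
        + ζ ^ (4 * ν) * GG4 v + ζ ^ (5 * ν) * GG5 v + ζ ^ (6 * ν) * GG6 v
        + ζ ^ (7 * ν) * GG7 v + ζ ^ (8 * ν) * GG8 v + ζ ^ (9 * ν) * GG9 v
        + ζ ^ (10 * ν) * GG10 v + ζ ^ (11 * ν) * GG11 v + ζ ^ (12 * ν) * GG12 v := by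
  have hy : (ζ ^ ν) ^ 13 = 1 := by
    rw [← pow_mul, mul_comm, pow_mul, isPrimitiveRoot_ζ.pow_eq_one, one_pow]
  obtain ⟨g0, g1, g2, g3, g4, g5, g6, g7, g8, g9, g10, g11, g12⟩ := GG_torusAct hy v
  have hS := GG0_mulVec_Smat (torusAct (ζ ^ ν) v)
  have hG := sum_GG_eq (torusAct (ζ ^ ν) v)
  rw [g0, g1, g2, g3, g4, g5, g6, g7, g8, g9, g10, g11, g12] at hG
  rw [← Matrix.mulVec_mulVec, mulVec_Tmat_pow]
  simp only [mul_comm _ ν, pow_mul]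
  linear_combination hS / 13 - hG
end
end

section
/- For every γ = (a b; c d) ∈ SL(2, ℤ) with a ≡ d ≡ 1 (mod 13) and b ≡ c ≡ 0 (mod 13), there exists u ∈ ℂ with u³ = 1 such that for every i ∈ {1,...,6} and every z in the upper half-plane ℍ, x_i((az+b)/(cz+d)) = u·(cz+d)·x_i(z). In other words, x₁, ..., x₆ are modular forms of weight 1 for the principal congruence subgroup Γ(13), all with the same cube-root-of-unity multiplier. -/
noncomputable section

open Complex

def th13 (c : ℚ) (k : ℤ) (z : ℂ) : ℂ :=
  Complex.exp (2 * Real.pi * Complex.I * (c : ℂ) * z) *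
    ∑' n : ℤ, (-1 : ℂ) ^ n *
      Complex.exp (2 * Real.pi * Complex.I * (((13 * n ^ 2 + k * n : ℤ) : ℂ) / 2) * z)

def ta : Fin 6 → ℂ → ℂ :=
  ![th13 (121 / 104) 11, th13 (49 / 104) 7, th13 (25 / 104) 5,
    fun z => -th13 (9 / 104) 3 z, th13 (81 / 104) 9, th13 (1 / 104) 1]

def AV (z : ℂ) : Fin 6 → ℂ := fun i => ta i z

def etaF (z : ℂ) : ℂ :=
  Complex.exp (2 * Real.pi * Complex.I * z / 24) *
    ∏' n : ℕ, (1 - Complex.exp (2 * Real.pi * Complex.I * z) ^ (n + 1))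

def xV (z : ℂ) : Fin 6 → ℂ := fun i => etaF z * ta i z

/-- An integral matrix of determinant one is a word in `S` and `T`, phrased through entries. -/
theorem sl2_entries_induction {P : ℤ → ℤ → ℤ → ℤ → Prop}
    (one : P 1 0 0 1) (S : P 0 (-1) 1 0) (T : P 1 1 0 1)
    (mul : ∀ a b c d a' b' c' d' : ℤ, a * d - b * c = 1 → a' * d' - b' * c' = 1 →
      P a b c d → P a' b' c' d' →
      P (a * a' + b * c') (a * b' + b * d') (c * a' + d * c') (c * b' + d * d'))
    (inv : ∀ a b c d : ℤ, a * d - b * c = 1 → P a b c d → P d (-b) (-c) a)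
    (a b c d : ℤ) (h : a * d - b * c = 1) : P a b c d := by
  have key : ∀ g : Matrix.SpecialLinearGroup (Fin 2) ℤ, P (g 0 0) (g 0 1) (g 1 0) (g 1 1) := by
    intro g
    have hg : g ∈ Subgroup.closure {ModularGroup.S, ModularGroup.T} := by
      rw [SpecialLinearGroup.SL2Z_generators]; trivial
    induction hg using Subgroup.closure_induction with
    | mem x hx =>
      rcases hx with rfl | rfl
      · simpa [ModularGroup.S] using S
      · simpa [ModularGroup.T] using T
    | one => simpa using one
    | mul x y _ _ hx hy =>
      have dx := x.det_coe
      have dy := y.det_coe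
      rw [Matrix.det_fin_two] at dx dy
      simpa [Matrix.mul_apply, Fin.sum_univ_two] using mul _ _ _ _ _ _ _ _ dx dy hx hy
    | inv x _ hx =>
      have dx := x.det_coe
      rw [Matrix.det_fin_two] at dx
      simpa [Matrix.SpecialLinearGroup.coe_inv, Matrix.adjugate_fin_two] using inv _ _ _ _ dx hx
  simpa using key ⟨!![a, b; c, d], by simpa [Matrix.det_fin_two] using h⟩

theorem moebius_denom_ne_zero {a b c d : ℤ} (h : a * d - b * c = 1) {z : ℂ} (hz : 0 < z.im) :
    (c : ℂ) * z + d ≠ 0 := by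
  intro h0
  have him := congrArg Complex.im h0
  have hre := congrArg Complex.re h0
  simp at him hre
  rcases him with rfl | h1
  · simp at hre
    subst hre
    simp at h
  · exact hz.ne' h1

theorem moebius_im_pos {a b c d : ℤ} (h : a * d - b * c = 1) {z : ℂ} (hz : 0 < z.im) :
    0 < (((a : ℂ) * z + b) / ((c : ℂ) * z + d)).im := by
  have hD := moebius_denom_ne_zero h hz
  have hN := Complex.normSq_pos.mpr hD
  have hR : (a : ℝ) * d - b * c = 1 := by exact_mod_cast h
  have : (((a : ℂ) * z + b) / ((c : ℂ) * z + d)).im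
      = z.im / Complex.normSq ((c : ℂ) * z + d) := by
    rw [Complex.div_im, ← sub_div]
    congr 1
    simp
    linear_combination z.im * hR
  rw [this]
  positivity

theorem moebius_mul {a b c d a' b' c' d' : ℤ} (h : a * d - b * c = 1)
    (h' : a' * d' - b' * c' = 1) {z : ℂ} (hz : 0 < z.im) :
    (c : ℂ) * (((a' : ℂ) * z + b') / ((c' : ℂ) * z + d')) + d
        = (((c * a' + d * c' : ℤ) : ℂ) * z + ((c * b' + d * d' : ℤ) : ℂ))
          / ((c' : ℂ) * z + d') ∧
    (((a * a' + b * c' : ℤ) : ℂ) * z + ((a * b' + b * d' : ℤ) : ℂ))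
        / (((c * a' + d * c' : ℤ) : ℂ) * z + ((c * b' + d * d' : ℤ) : ℂ))
      = ((a : ℂ) * (((a' : ℂ) * z + b') / ((c' : ℂ) * z + d')) + b) /
        ((c : ℂ) * (((a' : ℂ) * z + b') / ((c' : ℂ) * z + d')) + d) := by
  have hD' := moebius_denom_ne_zero h' hz
  have hD := moebius_denom_ne_zero h (moebius_im_pos h' hz)
  have h1 : (c : ℂ) * (((a' : ℂ) * z + b') / ((c' : ℂ) * z + d')) + d
        = (((c * a' + d * c' : ℤ) : ℂ) * z + ((c * b' + d * d' : ℤ) : ℂ))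
          / ((c' : ℂ) * z + d') := by
    rw [eq_div_iff hD', add_mul, mul_assoc, div_mul_cancel₀ _ hD']
    push_cast
    ring
  refine ⟨h1, ?_⟩
  have hE : (((c * a' + d * c' : ℤ) : ℂ) * z + ((c * b' + d * d' : ℤ) : ℂ)) ≠ 0 := by
    intro h0
    rw [h1, h0, zero_div] at hD
    exact hD rfl
  rw [h1]
  push_cast at hE ⊢
  field_simp
  ring

theorem moebius_inv {a b c d : ℤ} (h : a * d - b * c = 1) {z : ℂ} (hz : 0 < z.im) :
    (c : ℂ) * (((d : ℂ) * z + (-b : ℤ)) / (((-c : ℤ) : ℂ) * z + a)) + d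
        = 1 / (((-c : ℤ) : ℂ) * z + a) ∧
    ((a : ℂ) * (((d : ℂ) * z + (-b : ℤ)) / (((-c : ℤ) : ℂ) * z + a)) + b) /
      ((c : ℂ) * (((d : ℂ) * z + (-b : ℤ)) / (((-c : ℤ) : ℂ) * z + a)) + d) = z := by
  have h' : d * a - (-b) * (-c) = 1 := by linarith
  have hD' := moebius_denom_ne_zero h' hz
  have hC : (a : ℂ) * d - b * c = 1 := by exact_mod_cast h
  have h1 : (c : ℂ) * (((d : ℂ) * z + (-b : ℤ)) / (((-c : ℤ) : ℂ) * z + a)) + d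
        = 1 / (((-c : ℤ) : ℂ) * z + a) := by
    rw [eq_div_iff hD', add_mul, mul_assoc, div_mul_cancel₀ _ hD']
    push_cast
    linear_combination hC
  refine ⟨h1, ?_⟩
  rw [h1, div_div_eq_mul_div, div_one, add_mul, mul_assoc, div_mul_cancel₀ _ hD']
  push_cast
  linear_combination z * hC

theorem eta_add_one (z : ℂ) :
    ModularForm.eta (z + 1) = Complex.exp (2 * Real.pi * Complex.I / 24) * ModularForm.eta z := by
  have h1 : ∀ n, ModularForm.eta_q n (z + 1) = ModularForm.eta_q n z := by
    intro n
    rw [ModularForm.eta_q_eq_pow, ModularForm.eta_q_eq_pow, mul_add, mul_one, Complex.exp_add,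
      Complex.exp_two_pi_mul_I, mul_one]
  simp only [ModularForm.eta, h1, Function.Periodic.qParam]
  rw [← mul_assoc, ← Complex.exp_add]
  congr 2
  push_cast
  ring

/-- The eighth power of `η` has weight four for `SL(2, ℤ)` with a cubic character. -/
theorem eta_pow_eight_moebius (a b c d : ℤ) (h : a * d - b * c = 1) :
    ∃ ζ : ℂ, ζ ^ 3 = 1 ∧ ∀ z : ℂ, 0 < z.im →
      ModularForm.eta (((a : ℂ) * z + b) / ((c : ℂ) * z + d)) ^ 8
        = ζ * ((c : ℂ) * z + d) ^ 4 * ModularForm.eta z ^ 8 := by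
  refine sl2_entries_induction (P := fun a b c d => ∃ ζ : ℂ, ζ ^ 3 = 1 ∧
      ∀ z : ℂ, 0 < z.im → ModularForm.eta (((a : ℂ) * z + b) / ((c : ℂ) * z + d)) ^ 8
        = ζ * ((c : ℂ) * z + d) ^ 4 * ModularForm.eta z ^ 8) ?_ ?_ ?_ ?_ ?_ a b c d h
  · exact ⟨1, by simp⟩
  · refine ⟨1, by simp, fun z hz => ?_⟩
    have h1 := ModularForm.eta_comp_eq_csqrt_I_inv hz
    have hz0 : z ≠ 0 := by rintro rfl; simp at hz
    have hs : Complex.sqrt z ^ 8 = z ^ 4 := by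
      rw [sqrt_eq_exp hz0, ← Complex.exp_nat_mul]
      rw [show ((8 : ℕ) : ℂ) * (Complex.log z / 2) = (4 : ℕ) * Complex.log z by push_cast; ring,
        Complex.exp_nat_mul, Complex.exp_log hz0]
    have hI : Complex.sqrt I ^ 8 = 1 := by
      rw [sqrt_eq_exp I_ne_zero, ← Complex.exp_nat_mul]
      rw [show ((8 : ℕ) : ℂ) * (Complex.log I / 2) = (4 : ℕ) * Complex.log I by push_cast; ring,
        Complex.exp_nat_mul, Complex.exp_log I_ne_zero, Complex.I_pow_four]
    simp only [Function.comp, Pi.smul_apply, Pi.mul_apply, smul_eq_mul] at h1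
    simp only [Int.cast_zero, zero_mul, zero_add, Int.cast_neg, Int.cast_one, one_mul, add_zero]
    rw [h1, mul_pow, mul_pow, inv_pow, hI, hs]
    ring
  · refine ⟨Complex.exp (2 * Real.pi * Complex.I / 3), ?_, fun z hz => ?_⟩
    · rw [← Complex.exp_nat_mul, ← Complex.exp_two_pi_mul_I]
      congr 1
      push_cast
      ring
    · have hT := eta_add_one z
      simp only [Int.cast_one, one_mul, Int.cast_zero, zero_mul, zero_add, div_one, one_pow,
        mul_one]
      rw [hT, mul_pow, ← Complex.exp_nat_mul]
      congr 2
      push_cast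
      ring
  · rintro a b c d a' b' c' d' h h' ⟨ζ, hζ, H⟩ ⟨ζ', hζ', H'⟩
    refine ⟨ζ * ζ', by rw [mul_pow, hζ, hζ', one_mul], fun z hz => ?_⟩
    obtain ⟨h1, h2⟩ := moebius_mul h h' hz
    rw [h2, H _ (moebius_im_pos h' hz), H' z hz, h1]
    have h0 := moebius_denom_ne_zero h' hz
    generalize (c' : ℂ) * z + d' = D at h0
    field_simp
  · rintro a b c d h ⟨ζ, hζ, H⟩
    have hζ0 : ζ ≠ 0 := by rintro rfl; simp at hζ
    refine ⟨ζ⁻¹, by rw [inv_pow, hζ, inv_one], fun z hz => ?_⟩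
    have h' : d * a - (-b) * (-c) = 1 := by linarith
    obtain ⟨h1, h2⟩ := moebius_inv h hz
    have := H _ (moebius_im_pos h' hz)
    rw [h2, h1] at this
    have h0 := moebius_denom_ne_zero h' hz
    rw [this]
    generalize ((-c : ℤ) : ℂ) * z + a = D at h0
    field_simp

/-- The odd Jacobi theta function
`∑ n, (-1) ^ n * exp (π i (n + 1/2) ^ 2 τ + 2 π i (n + 1/2) u)`. -/
def oddTheta (u τ : ℂ) : ℂ :=
  Complex.exp (Real.pi * I * τ / 4 + Real.pi * I * u) * jacobiTheta₂ (u + 1 / 2 + τ / 2) τ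

theorem oddTheta_add_two (u τ : ℂ) : oddTheta (u + 2) τ = oddTheta u τ := by
  have h1 : jacobiTheta₂ (u + 2 + 1 / 2 + τ / 2) τ = jacobiTheta₂ (u + 1 / 2 + τ / 2) τ := by
    rw [← jacobiTheta₂_add_left (u + 1 / 2 + τ / 2), ← jacobiTheta₂_add_left (_ + 1)]
    congr 1
    ring
  rw [oddTheta, oddTheta, h1,
    show Real.pi * I * τ / 4 + Real.pi * I * (u + 2)
      = Real.pi * I * τ / 4 + Real.pi * I * u + 2 * Real.pi * I by ring,
    Complex.exp_add _ (2 * Real.pi * I), Complex.exp_two_pi_mul_I, mul_one]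

theorem oddTheta_add_two_mul_right (u τ : ℂ) :
    oddTheta (u + 2 * τ) τ
      = Complex.exp (-4 * Real.pi * I * τ - 4 * Real.pi * I * u) * oddTheta u τ := by
  rw [oddTheta, oddTheta,
    show u + 2 * τ + 1 / 2 + τ / 2 = u + 1 / 2 + τ / 2 + τ + τ by ring,
    jacobiTheta₂_add_left', jacobiTheta₂_add_left', ← mul_assoc, ← mul_assoc, ← mul_assoc,
    ← Complex.exp_add, ← Complex.exp_add, ← Complex.exp_add]
  congr 1
  rw [Complex.exp_eq_exp_iff_exists_int]
  exact ⟨-1, by push_cast; ring⟩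

theorem oddTheta_add_even (n : ℤ) (u τ : ℂ) : oddTheta (u + 2 * n) τ = oddTheta u τ := by
  induction n using Int.induction_on with
  | zero => simp
  | succ n ih =>
    rw [← ih, ← oddTheta_add_two (u + 2 * ((n : ℤ) : ℂ))]
    push_cast
    congr 1
    ring
  | pred n ih =>
    rw [← ih, ← oddTheta_add_two (u + 2 * ((-n - 1 : ℤ) : ℂ))]
    push_cast
    congr 1
    ring

theorem oddTheta_add_even_mul_right (m : ℤ) (u τ : ℂ) :
    oddTheta (u + 2 * m * τ) τ
      = Complex.exp (-4 * Real.pi * I * m ^ 2 * τ - 4 * Real.pi * I * m * u) * oddTheta u τ := by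
  induction m using Int.induction_on with
  | zero => simp
  | succ m ih =>
    rw [show u + 2 * ((m + 1 : ℤ) : ℂ) * τ = u + 2 * ((m : ℤ) : ℂ) * τ + 2 * τ by
        push_cast; ring,
      oddTheta_add_two_mul_right, ih, ← mul_assoc, ← Complex.exp_add]
    congr 2
    push_cast
    ring
  | pred m ih =>
    have h1 := oddTheta_add_two_mul_right (u + 2 * ((-m - 1 : ℤ) : ℂ) * τ) τ
    rw [show u + 2 * ((-m - 1 : ℤ) : ℂ) * τ + 2 * τ = u + 2 * ((-m : ℤ) : ℂ) * τ by
        push_cast; ring, ih] at h1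
    apply mul_left_cancel₀ (Complex.exp_ne_zero
      (-4 * Real.pi * I * τ - 4 * Real.pi * I * (u + 2 * ((-m - 1 : ℤ) : ℂ) * τ)))
    rw [← h1, ← mul_assoc, ← Complex.exp_add]
    congr 2
    push_cast
    ring

theorem oddTheta_add_one_right (u τ : ℂ) :
    oddTheta u (τ + 1) = Complex.exp (Real.pi * I / 4) * oddTheta u τ := by
  rw [oddTheta, oddTheta, jacobiTheta₂, jacobiTheta₂, ← tsum_mul_left, ← tsum_mul_left,
    ← tsum_mul_left]
  refine tsum_congr fun n => ?_
  rw [jacobiTheta₂_term, jacobiTheta₂_term, ← Complex.exp_add, ← Complex.exp_add,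
    ← Complex.exp_add, Complex.exp_eq_exp_iff_exists_int]
  obtain ⟨k, hk⟩ := Int.even_mul_succ_self n
  have hk' : (n : ℂ) * (n + 1) = k + k := by exact_mod_cast hk
  exact ⟨k, by linear_combination (Real.pi * I) * hk'⟩

theorem oddTheta_functional_equation (u : ℂ) {τ : ℂ} (hτ : 0 < τ.im) :
    I * oddTheta (u / τ) (-1 / τ)
      = (-I * τ) ^ (1 / 2 : ℂ) * Complex.exp (Real.pi * I * u ^ 2 / τ) * oddTheta u τ := by
  have hτ0 : τ ≠ 0 := by rintro rfl; simp at hτ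
  have hr : (-I * τ) ^ (1 / 2 : ℂ) ≠ 0 := by
    rw [Complex.cpow_def_of_ne_zero (by simp [hτ0])]
    exact Complex.exp_ne_zero _
  have h1 := jacobiTheta₂_functional_equation (u + 1 / 2 + τ / 2) τ
  have h2 := jacobiTheta₂_add_left' ((u + 1 / 2 + τ / 2) / τ) (-1 / τ)
  have h3 : (u + 1 / 2 + τ / 2) / τ = u / τ + 1 / 2 + (-1 / τ) / 2 + -1 * (-1 / τ) := by
    field_simp
    ring
  have h4 : (u + 1 / 2 + τ / 2) / τ + -1 / τ = u / τ + 1 / 2 + (-1 / τ) / 2 := by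
    field_simp
    ring
  rw [h4] at h2
  rw [oddTheta, oddTheta, h1, h2]
  generalize jacobiTheta₂ ((u + 1 / 2 + τ / 2) / τ) (-1 / τ) = J
  generalize (-I * τ) ^ (1 / 2 : ℂ) = r at hr
  have hI : Complex.exp (Real.pi / 2 * I) = I := Complex.exp_pi_div_two_mul_I
  calc _ = Complex.exp (Real.pi / 2 * I) * (Complex.exp (Real.pi * I * (-1 / τ) / 4
          + Real.pi * I * (u / τ)) * (Complex.exp (-Real.pi * I * (-1 / τ
          + 2 * ((u + 1 / 2 + τ / 2) / τ))) * J)) := by rw [hI]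
    _ = Complex.exp (Real.pi * I * u ^ 2 / τ) * (Complex.exp (Real.pi * I * τ / 4
          + Real.pi * I * u) * (Complex.exp (-Real.pi * I * (u + 1 / 2 + τ / 2) ^ 2 / τ) * J)) := by
      simp only [← mul_assoc, ← Complex.exp_add]
      congr 2
      field_simp
      ring
    _ = _ := by
      field_simp

theorem sqrt_I_inv_mul_sqrt {τ : ℂ} (hτ : 0 < τ.im) :
    (Complex.sqrt I)⁻¹ * Complex.sqrt τ = (-I * τ) ^ (1 / 2 : ℂ) := by
  have hτ0 : τ ≠ 0 := by rintro rfl; simp at hτ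
  have hlog : Complex.log (-I * τ) = Complex.log (-I) + Complex.log τ := by
    apply Complex.log_mul (by simp) hτ0
    have h1 := Complex.arg_nonneg_iff.mpr hτ.le
    have h2 := Complex.arg_le_pi τ
    rw [Complex.arg_neg_I]
    constructor <;> linarith [Real.pi_pos]
  rw [sqrt_eq_exp I_ne_zero, sqrt_eq_exp hτ0, ← Complex.exp_neg, ← Complex.exp_add,
    Complex.cpow_def_of_ne_zero (by simp [hτ0]), hlog, Complex.log_neg_I, Complex.log_I]
  congr 1
  ring

/-- The quotient of the odd theta function by `η ^ 3` transforms under `SL(2, ℤ)` like a Jacobi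
form of weight `-1` and index `1 / 2`, with trivial multiplier. -/
theorem oddTheta_moebius (a b c d : ℤ) (h : a * d - b * c = 1) :
    ∀ u τ : ℂ, 0 < τ.im →
      oddTheta (u / ((c : ℂ) * τ + d)) (((a : ℂ) * τ + b) / ((c : ℂ) * τ + d))
          * ModularForm.eta τ ^ 3 * ((c : ℂ) * τ + d)
        = Complex.exp (Real.pi * I * c * u ^ 2 / ((c : ℂ) * τ + d)) * oddTheta u τ
          * ModularForm.eta (((a : ℂ) * τ + b) / ((c : ℂ) * τ + d)) ^ 3 := by
  refine sl2_entries_induction (P := fun a b c d => ∀ u τ : ℂ, 0 < τ.im →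
      oddTheta (u / ((c : ℂ) * τ + d)) (((a : ℂ) * τ + b) / ((c : ℂ) * τ + d))
          * ModularForm.eta τ ^ 3 * ((c : ℂ) * τ + d)
        = Complex.exp (Real.pi * I * c * u ^ 2 / ((c : ℂ) * τ + d)) * oddTheta u τ
          * ModularForm.eta (((a : ℂ) * τ + b) / ((c : ℂ) * τ + d)) ^ 3)
    ?_ ?_ ?_ ?_ ?_ a b c d h
  · simp
  · intro u τ hτ
    have hτ0 : τ ≠ 0 := by rintro rfl; simp at hτ
    have h1 := ModularForm.eta_comp_eq_csqrt_I_inv hτ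
    have h2 := oddTheta_functional_equation u hτ
    simp only [Function.comp, Pi.smul_apply, Pi.mul_apply, smul_eq_mul] at h1
    simp only [Int.cast_zero, zero_mul, zero_add, Int.cast_neg, Int.cast_one, one_mul, add_zero,
      mul_one]
    rw [h1, ← mul_assoc, sqrt_I_inv_mul_sqrt hτ]
    have hr : ((-I * τ) ^ (1 / 2 : ℂ)) ^ 2 = -I * τ := by
      rw [← Complex.cpow_nat_mul]
      norm_num
    generalize (-I * τ) ^ (1 / 2 : ℂ) = r at hr h2
    generalize Complex.exp (Real.pi * I * u ^ 2 / τ) = e at h2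
    generalize oddTheta (u / τ) (-1 / τ) = X at h2
    linear_combination (-I * ModularForm.eta τ ^ 3 * τ) * h2
      - (e * oddTheta u τ * ModularForm.eta τ ^ 3 * r) * hr
      + (X * ModularForm.eta τ ^ 3 * τ) * Complex.I_sq
  · intro u τ hτ
    simp only [Int.cast_one, one_mul, Int.cast_zero, zero_mul, zero_add, div_one, mul_zero,
      mul_one, Complex.exp_zero]
    rw [oddTheta_add_one_right, eta_add_one, mul_pow, ← Complex.exp_nat_mul]
    rw [show ((3 : ℕ) : ℂ) * (2 * Real.pi * I / 24) = Real.pi * I / 4 by push_cast; ring]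
    ring
  · intro a b c d a' b' c' d' h h' H H' u τ hτ
    obtain ⟨h1, h2⟩ := moebius_mul h h' hτ
    have hH' := H' u τ hτ
    have hH := H (u / ((c' : ℂ) * τ + d')) _ (moebius_im_pos h' hτ)
    have hη := ModularForm.eta_ne_zero (moebius_im_pos h' hτ)
    have hD := moebius_denom_ne_zero h (moebius_im_pos h' hτ)
    have hD' := moebius_denom_ne_zero h' hτ
    rw [← h2, h1] at hH
    rw [h1] at hD
    have hE : (((c * a' + d * c' : ℤ) : ℂ) * τ + ((c * b' + d * d' : ℤ) : ℂ)) ≠ 0 :=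
      (div_ne_zero_iff.mp hD).1
    rw [div_div_div_cancel_right₀ hD'] at hH
    have hexp : Complex.exp (Real.pi * I * ((c * a' + d * c' : ℤ) : ℂ) * u ^ 2 /
          (((c * a' + d * c' : ℤ) : ℂ) * τ + ((c * b' + d * d' : ℤ) : ℂ)))
        = Complex.exp (Real.pi * I * c * (u / ((c' : ℂ) * τ + d')) ^ 2 /
          ((((c * a' + d * c' : ℤ) : ℂ) * τ + ((c * b' + d * d' : ℤ) : ℂ))
            / ((c' : ℂ) * τ + d')))
          * Complex.exp (Real.pi * I * c' * u ^ 2 / ((c' : ℂ) * τ + d')) := by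
      rw [← Complex.exp_add]
      congr 1
      have hdet : (a' : ℂ) * d' - b' * c' = 1 := by exact_mod_cast h'
      have key : (c : ℂ) + c' * (((c * a' + d * c' : ℤ) : ℂ) * τ + ((c * b' + d * d' : ℤ) : ℂ))
          = ((c * a' + d * c' : ℤ) : ℂ) * ((c' : ℂ) * τ + d') := by
        push_cast
        linear_combination -(c : ℂ) * hdet
      generalize (((c * a' + d * c' : ℤ) : ℂ) * τ + ((c * b' + d * d' : ℤ) : ℂ)) = E at *
      generalize (c' : ℂ) * τ + d' = D at *
      field_simp
      linear_combination -u ^ 2 * key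
    rw [hexp]
    generalize (((c * a' + d * c' : ℤ) : ℂ) * τ + ((c * b' + d * d' : ℤ) : ℂ)) = E at *
    generalize (c' : ℂ) * τ + d' = D at *
    apply mul_left_cancel₀ (pow_ne_zero 3 hη)
    rw [mul_div_assoc', div_eq_iff hD'] at hH
    linear_combination ModularForm.eta τ ^ 3 * hH
      + Complex.exp (Real.pi * I * c * (u / D) ^ 2 / (E / D))
        * ModularForm.eta ((((a * a' + b * c' : ℤ) : ℂ) * τ + ((a * b' + b * d' : ℤ) : ℂ)) / E) ^ 3
        * hH'
  · intro a b c d h H u τ hτ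
    obtain ⟨h1, h2⟩ := moebius_inv h hτ
    have h' : d * a - (-b) * (-c) = 1 := by linarith
    have hD' := moebius_denom_ne_zero h' hτ
    have hH := H (u / (((-c : ℤ) : ℂ) * τ + a)) _ (moebius_im_pos h' hτ)
    rw [h2, h1] at hH
    generalize hD : ((-c : ℤ) : ℂ) * τ + a = D at *
    rw [show u / D / (1 / D) = u by field_simp,
      show Real.pi * I * c * (u / D) ^ 2 / (1 / D) = Real.pi * I * c * u ^ 2 / D by
        field_simp] at hH
    rw [show Real.pi * I * ((-c : ℤ) : ℂ) * u ^ 2 / D = -(Real.pi * I * c * u ^ 2 / D) by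
        push_cast; ring, Complex.exp_neg]
    have he := Complex.exp_ne_zero (Real.pi * I * c * u ^ 2 / D)
    field_simp at hH ⊢
    linear_combination -hH

section JacobiTripleProduct

open Filter Topology

/-- The reciprocal `1 / ((1 - q) ⋯ (1 - q ^ m))`, extended by zero to negative `m`. -/
def qPochInv (q : ℂ) (m : ℤ) : ℂ :=
  if m < 0 then 0 else (∏ i ∈ Finset.range m.toNat, (1 - q ^ (i + 1)))⁻¹

theorem one_sub_pow_succ_ne_zero {q : ℂ} (hq : ‖q‖ < 1) (n : ℕ) : 1 - q ^ (n + 1) ≠ 0 := by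
  intro h
  have h1 : ‖q ^ (n + 1)‖ < 1 := by
    rw [norm_pow]
    exact pow_lt_one₀ (norm_nonneg _) hq (Nat.succ_ne_zero n)
  rw [← sub_eq_zero.mp h, norm_one] at h1
  exact lt_irrefl _ h1

theorem qPochInv_sub_one {q : ℂ} (hq : ‖q‖ < 1) (m : ℤ) :
    qPochInv q (m - 1) = (1 - q ^ m) * qPochInv q m := by
  rcases lt_trichotomy m 0 with h | rfl | h
  · simp [qPochInv, h, show m - 1 < 0 by lia]
  · simp [qPochInv]
  · obtain ⟨n, rfl⟩ : ∃ n : ℕ, m = n + 1 := ⟨(m - 1).toNat, by lia⟩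
    have h0 := one_sub_pow_succ_ne_zero hq n
    have h1 : ((n : ℤ) + 1).toNat = n + 1 := by lia
    rw [qPochInv, qPochInv, if_neg (by lia), if_neg (by lia), add_sub_cancel_right,
      Int.toNat_natCast, h1, Finset.prod_range_succ, mul_inv, ← Nat.cast_succ, zpow_natCast, Nat.succ_eq_add_one]
    field_simp

/-- The finite form of the Jacobi triple product. The sequence `T` is
`T k = (-1) ^ k q ^ (k (k - 1) / 2) x ^ k`, given by its recursion. -/
theorem hasSum_finite_triple_product {q x : ℂ} (hq : ‖q‖ < 1) (hq0 : q ≠ 0) (hx : x ≠ 0)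
    {T : ℤ → ℂ} (hT0 : T 0 = 1) (hT : ∀ k, T (k + 1) = -(q ^ k * x) * T k) (N : ℕ) :
    HasSum (fun k : ℤ => T k * ((∏ i ∈ Finset.range (2 * N), (1 - q ^ (i + 1)))
        * qPochInv q (N - k) * qPochInv q (N + k)))
      (∏ n ∈ Finset.range N, (1 - q ^ n * x) * (1 - q ^ (n + 1) / x)) := by
  induction N with
  | zero =>
    convert hasSum_ite_eq (0 : ℤ) (1 : ℂ) using 2 with k
    rcases lt_trichotomy k 0 with h | rfl | h
    · simp [qPochInv, h, h.ne]
    · simp [qPochInv, hT0]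
    · simp [qPochInv, h, h.ne']
    · simp
  | succ N ih =>
    have hm := (Equiv.subRight (1 : ℤ)).hasSum_iff.mpr ih
    have hp := (Equiv.addRight (1 : ℤ)).hasSum_iff.mpr ih
    have := ((ih.mul_left (1 + q ^ (2 * N + 1))).sub (hm.mul_left (q ^ N * x))).sub
      (hp.mul_left (q ^ (N + 1) / x))
    refine Eq.mpr (congrArg₂ (fun f s => HasSum f s) (funext fun k => ?_) ?_) this
    · simp only [Function.comp, Equiv.subRight_apply, Equiv.coe_addRight]
      have hk : q ^ k ≠ 0 := zpow_ne_zero _ hq0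
      have hTm : q ^ N * x * T (k - 1) = -(q ^ N * q / q ^ k) * T k := by
        have := hT (k - 1)
        rw [sub_add_cancel, zpow_sub₀ hq0, zpow_one] at this
        rw [this]
        field_simp
      have hTp : q ^ (N + 1) / x * T (k + 1) = -(q ^ (N + 1) * q ^ k) * T k := by
        rw [hT]
        field_simp
      have e1 : ((N + 1 : ℕ) : ℤ) - k = N - k + 1 := by push_cast; ring
      have e2 : ((N + 1 : ℕ) : ℤ) + k = N + k + 1 := by push_cast; ring
      have e3 : (N : ℤ) - (k - 1) = N - k + 1 := by ring
      have e4 : (N : ℤ) + (k - 1) = N + k - 1 := by ring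
      have e5 : (N : ℤ) - (k + 1) = N - k - 1 := by ring
      have e6 : (N : ℤ) + (k + 1) = N + k + 1 := by ring
      have i1 := qPochInv_sub_one hq ((N : ℤ) - k)
      have i2 := qPochInv_sub_one hq ((N : ℤ) - k + 1)
      have i3 := qPochInv_sub_one hq ((N : ℤ) + k)
      have i4 := qPochInv_sub_one hq ((N : ℤ) + k + 1)
      rw [add_sub_cancel_right] at i2 i4
      rw [e1, e2, e3, e4, e5, e6, i1, i3, i2, i4, ← mul_assoc (q ^ N * x), hTm,
        ← mul_assoc (q ^ (N + 1) / x), hTp]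
      rw [show 2 * (N + 1) = 2 * N + 1 + 1 by ring, Finset.prod_range_succ, Finset.prod_range_succ]
      simp only [zpow_add₀ hq0, zpow_sub₀ hq0, zpow_natCast, zpow_one]
      generalize qPochInv q ((N : ℤ) - k + 1) = A
      generalize qPochInv q ((N : ℤ) + k + 1) = B
      generalize ∏ i ∈ Finset.range (2 * N), (1 - q ^ (i + 1)) = C
      generalize T k = t
      generalize q ^ k = y at hk
      field_simp
      ring
    · rw [Finset.prod_range_succ]
      linear_combination (q ^ N * q ^ (N + 1)
        * ∏ n ∈ Finset.range N, (1 - q ^ n * x) * (1 - q ^ (n + 1) / x)) * mul_inv_cancel₀ hx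

theorem multipliable_one_sub_pow_mul {q : ℂ} (hq : ‖q‖ < 1) (y : ℂ) :
    Multipliable fun n : ℕ => 1 - q ^ n * y := by
  simp_rw [sub_eq_add_neg]
  apply multipliable_one_add_of_summable
  simpa [norm_mul, norm_pow] using
    (summable_geometric_of_lt_one (norm_nonneg _) hq).mul_right ‖y‖

theorem tprod_one_sub_pow_ne_zero {q : ℂ} (hq : ‖q‖ < 1) : ∏' n : ℕ, (1 - q ^ (n + 1)) ≠ 0 := by
  simp_rw [sub_eq_add_neg]
  refine tprod_one_add_ne_zero_of_summable (f := fun n ↦ -q ^ (n + 1)) ?_ ?_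
  · intro n
    simpa [← sub_eq_add_neg] using one_sub_pow_succ_ne_zero hq n
  · simpa using (summable_nat_add_iff 1).mpr (summable_geometric_of_lt_one (norm_nonneg _) hq)

theorem tendsto_qPochInv {q : ℂ} (hq : ‖q‖ < 1) :
    Tendsto (qPochInv q) atTop (𝓝 (∏' n : ℕ, (1 - q ^ (n + 1)))⁻¹) := by
  have h1 := ((ModularForm.multipliable_one_sub_pow hq).hasProd.tendsto_prod_nat).inv₀
    (tprod_one_sub_pow_ne_zero hq)
  have h2 : Tendsto (fun m : ℤ => m.toNat) atTop atTop :=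
    tendsto_atTop.mpr fun b => by
      filter_upwards [eventually_ge_atTop (b : ℤ)] with m hm
      lia
  refine (h1.comp h2).congr' ?_
  filter_upwards [eventually_ge_atTop 0] with m hm
  simp [qPochInv, not_lt.mpr hm]

theorem exists_bound_qPochInv {q : ℂ} (hq : ‖q‖ < 1) : ∃ B : ℝ, ∀ m, ‖qPochInv q m‖ ≤ B := by
  have h1 : Tendsto (fun n : ℕ => qPochInv q n) atTop _ :=
    (tendsto_qPochInv hq).comp tendsto_natCast_atTop_atTop
  obtain ⟨B, hB⟩ := h1.norm.bddAbove_range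
  refine ⟨B, fun m => ?_⟩
  have hB' : ∀ n : ℕ, ‖qPochInv q n‖ ≤ B := fun n => hB ⟨n, rfl⟩
  rcases lt_or_ge m 0 with h | h
  · simpa [qPochInv, h] using (norm_nonneg _).trans (hB' 0)
  · obtain ⟨n, rfl⟩ := Int.eq_ofNat_of_zero_le h
    exact hB' n

/-- The Jacobi triple product identity, with
`T k = (-1) ^ k q ^ (k (k - 1) / 2) x ^ k` given by its recursion. -/
theorem tsum_eq_triple_product {q x : ℂ} (hq : ‖q‖ < 1) (hq0 : q ≠ 0) (hx : x ≠ 0)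
    {T : ℤ → ℂ} (hT0 : T 0 = 1) (hT : ∀ k, T (k + 1) = -(q ^ k * x) * T k) (hs : Summable T) :
    ∑' k, T k = (∏' n : ℕ, (1 - q ^ (n + 1))) *
      ((∏' n : ℕ, (1 - q ^ n * x)) * ∏' n : ℕ, (1 - q ^ (n + 1) / x)) := by
  have hm : Multipliable fun n : ℕ => 1 - q ^ (n + 1) / x := by
    convert multipliable_one_sub_pow_mul hq (q / x) using 2 with n
    rw [pow_succ, mul_div_assoc]
  have hP : ∏' n : ℕ, (1 - q ^ (n + 1)) ≠ 0 := tprod_one_sub_pow_ne_zero hq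
  have hN := (ModularForm.multipliable_one_sub_pow hq).hasProd.tendsto_prod_nat
  have h2N : Tendsto (fun N : ℕ => ∏ i ∈ Finset.range (2 * N), (1 - q ^ (i + 1))) atTop
      (𝓝 (∏' n : ℕ, (1 - q ^ (n + 1)))) :=
    hN.comp (tendsto_id.const_mul_atTop' two_pos)
  obtain ⟨B, hB⟩ := exists_bound_qPochInv hq
  obtain ⟨C, hC⟩ := h2N.norm.bddAbove_range
  have hC' : ∀ N : ℕ, ‖∏ i ∈ Finset.range (2 * N), (1 - q ^ (i + 1))‖ ≤ C := fun N => hC ⟨N, rfl⟩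
  have hlim := tendsto_tsum_of_dominated_convergence (𝓕 := atTop)
    (f := fun (N : ℕ) (k : ℤ) => T k * ((∏ i ∈ Finset.range (2 * N), (1 - q ^ (i + 1)))
        * qPochInv q (N - k) * qPochInv q (N + k)))
    (g := fun k => T k * ((∏' n : ℕ, (1 - q ^ (n + 1))) * (∏' n : ℕ, (1 - q ^ (n + 1)))⁻¹
      * (∏' n : ℕ, (1 - q ^ (n + 1)))⁻¹))
    (bound := fun k => ‖T k‖ * (C * B * B)) (hs.norm.mul_right _)
    (fun k => by
      refine tendsto_const_nhds.mul ((h2N.mul ?_).mul ?_)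
      · exact (tendsto_qPochInv hq).comp
          (tendsto_atTop_add_const_right _ (-k) tendsto_natCast_atTop_atTop)
      · exact (tendsto_qPochInv hq).comp
          (tendsto_atTop_add_const_right _ k tendsto_natCast_atTop_atTop))
    (Eventually.of_forall fun N k => by
      have hB0 : 0 ≤ B := (norm_nonneg _).trans (hB 0)
      have hC0 : 0 ≤ C := (norm_nonneg _).trans (hC' 0)
      rw [norm_mul, norm_mul, norm_mul]
      gcongr
      · exact hC' N
      · exact hB _
      · exact hB _)
  simp_rw [(hasSum_finite_triple_product hq hq0 hx hT0 hT _).tsum_eq, Finset.prod_mul_distrib]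
    at hlim
  have hlim' := ((multipliable_one_sub_pow_mul hq x).hasProd.tendsto_prod_nat).mul
    hm.hasProd.tendsto_prod_nat
  have := tendsto_nhds_unique hlim hlim'
  rw [tsum_mul_right, mul_inv_cancel₀ hP, one_mul] at this
  rw [← this]
  field_simp

end JacobiTripleProduct

section Order13

open Filter Topology

theorem th13_eq_jacobiTheta₂ (c : ℚ) (k : ℤ) (z : ℂ) :
    th13 c k z
      = Complex.exp (2 * Real.pi * I * c * z) * jacobiTheta₂ (1 / 2 + k * z / 2) (13 * z) := by
  rw [th13, jacobiTheta₂]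
  congr 1
  refine tsum_congr fun n => ?_
  rw [jacobiTheta₂_term, ← Complex.exp_pi_mul_I, ← Complex.exp_int_mul, ← Complex.exp_add]
  congr 1
  push_cast
  ring

theorem jacobiTheta₂_half_sub (u τ : ℂ) :
    jacobiTheta₂ (1 / 2 - u) τ = jacobiTheta₂ (1 / 2 + u) τ := by
  rw [← jacobiTheta₂_neg_left, ← jacobiTheta₂_add_left]
  congr 1
  ring

theorem th13_neg (c : ℚ) (k : ℤ) (z : ℂ) : th13 c (-k) z = th13 c k z := by
  rw [th13_eq_jacobiTheta₂, th13_eq_jacobiTheta₂, ← jacobiTheta₂_half_sub (k * z / 2)]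
  congr 2
  push_cast
  ring

theorem th13_eq_oddTheta (j : ℤ) (z : ℂ) :
    th13 ((13 + 2 * j) ^ 2 / 104) (13 + 2 * j) z
      = Complex.exp (Real.pi * I * j ^ 2 * z / 13) * oddTheta (j * z) (13 * z) := by
  rw [th13_eq_jacobiTheta₂, oddTheta, ← mul_assoc, ← Complex.exp_add]
  congr 1
  · congr 1
    push_cast
    ring
  · congr 1
    push_cast
    ring

/-- For `γ` in `Γ(13)`, the theta constant `exp (π i (2 j) ^ 2 z / 13) * θ(2 j z, 13 z)` transforms
under `γ` by a factor independent of `j`. -/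
theorem oddTheta_moebius_level_thirteen {a b c d : ℤ} (h : a * d - b * c = 1)
    (ha : a ≡ 1 [ZMOD 13]) (hb : b ≡ 0 [ZMOD 13]) (hc : c ≡ 0 [ZMOD 13]) (j : ℤ) {z : ℂ}
    (hz : 0 < z.im) :
    Complex.exp (Real.pi * I * ((2 * j : ℤ) : ℂ) ^ 2 * ((a * z + b) / (c * z + d)) / 13)
        * oddTheta ((2 * j : ℤ) * ((a * z + b) / (c * z + d))) (13 * ((a * z + b) / (c * z + d)))
        * ModularForm.eta (13 * z) ^ 3 * (c * z + d)
      = Complex.exp (Real.pi * I * ((2 * j : ℤ) : ℂ) ^ 2 * z / 13)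
        * oddTheta ((2 * j : ℤ) * z) (13 * z)
        * ModularForm.eta (13 * ((a * z + b) / (c * z + d))) ^ 3 := by
  obtain ⟨a', ha'⟩ := ha.symm.dvd
  obtain ⟨b', hb'⟩ := Int.modEq_zero_iff_dvd.mp hb
  obtain ⟨c', rfl⟩ := Int.modEq_zero_iff_dvd.mp hc
  obtain rfl : a = 1 + 13 * a' := by lia
  have hD := moebius_denom_ne_zero h hz
  have hC : ((1 + 13 * a' : ℤ) : ℂ) * d - b * ((13 * c' : ℤ) : ℂ) = 1 := by exact_mod_cast h
  have hbC : (b : ℂ) = 13 * b' := by exact_mod_cast hb'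
  have key := oddTheta_moebius (1 + 13 * a') (13 * b) c' d (by linarith)
    ((2 * j : ℤ) * ((1 + 13 * a' : ℤ) * z + b)) (13 * z) (by simpa using hz)
  have e1 : (c' : ℂ) * (13 * z) + d = ((13 * c' : ℤ) : ℂ) * z + d := by push_cast; ring
  have e2 : ((1 + 13 * a' : ℤ) : ℂ) * (13 * z) + (13 * b : ℤ)
      = 13 * (((1 + 13 * a' : ℤ) : ℂ) * z + b) := by push_cast; ring
  have e3 : ((2 * j : ℤ) : ℂ) * ((1 + 13 * a' : ℤ) * z + b)
      = ((2 * j : ℤ) : ℂ) * z + 2 * (j * a' : ℤ) * (13 * z) + 2 * (j * b : ℤ) := by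
    push_cast; ring
  rw [e1, e2, mul_div_assoc, mul_div_assoc, e3, oddTheta_add_even, oddTheta_add_even_mul_right,
    ← e3] at key
  have e4 : Complex.exp (Real.pi * I * ((2 * j : ℤ) : ℂ) ^ 2
        * ((((1 + 13 * a' : ℤ) : ℂ) * z + b) / (((13 * c' : ℤ) : ℂ) * z + d)) / 13)
      * Complex.exp (Real.pi * I * c' * (((2 * j : ℤ) : ℂ) * ((1 + 13 * a' : ℤ) * z + b)) ^ 2
        / (((13 * c' : ℤ) : ℂ) * z + d))
      * Complex.exp (-4 * Real.pi * I * ((j * a' : ℤ) : ℂ) ^ 2 * (13 * z)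
        - 4 * Real.pi * I * ((j * a' : ℤ) : ℂ) * (((2 * j : ℤ) : ℂ) * z))
      = Complex.exp (Real.pi * I * ((2 * j : ℤ) : ℂ) ^ 2 * z / 13) := by
    rw [← Complex.exp_add, ← Complex.exp_add, Complex.exp_eq_exp_iff_exists_int]
    refine ⟨2 * j ^ 2 * (1 + 13 * a') * b', ?_⟩
    have hd : (d : ℂ) * (1 + 13 * a') = 1 + 169 * b' * c' := by
      rw [hbC] at hC
      push_cast at hC
      linear_combination hC
    rw [hbC]
    have hD' : 13 * z * c' + d ≠ 0 := by
      convert hD using 1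
      push_cast
      ring
    rw [show ((13 * c' : ℤ) : ℂ) * z + d = 13 * z * c' + d by push_cast; ring]
    push_cast
    field_simp
    linear_combination (-4 * (j : ℂ) ^ 2 * ((1 + 13 * a') * z + 13 * b')) * hd
  rw [← e4]
  linear_combination Complex.exp (Real.pi * I * ((2 * j : ℤ) : ℂ) ^ 2
        * ((((1 + 13 * a' : ℤ) : ℂ) * z + b) / (((13 * c' : ℤ) : ℂ) * z + d)) / 13) * key

theorem jacobiTheta₂_eq_triple_product {z : ℂ} (hz : 0 < z.im) {l l' : ℕ} (hl : l + l' = 13) :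
    jacobiTheta₂ (1 / 2 + ((2 * l - 13 : ℤ) : ℂ) * z / 2) (13 * z)
      = (∏' n : ℕ, (1 - Complex.exp (2 * Real.pi * I * z) ^ (13 * n + 13))) *
        ((∏' n : ℕ, (1 - Complex.exp (2 * Real.pi * I * z) ^ (13 * n + l))) *
          ∏' n : ℕ, (1 - Complex.exp (2 * Real.pi * I * z) ^ (13 * n + l'))) := by
  set p := Complex.exp (2 * Real.pi * I * z) with hp
  have hp0 : p ≠ 0 := Complex.exp_ne_zero _
  have hp1 : ‖p‖ < 1 := by
    rw [hp, Complex.norm_exp]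
    simpa using by positivity
  have hT : ∀ n : ℤ, jacobiTheta₂_term (n + 1) (1 / 2 + ((2 * l - 13 : ℤ) : ℂ) * z / 2) (13 * z)
      = -((p ^ 13) ^ n * p ^ l)
        * jacobiTheta₂_term n (1 / 2 + ((2 * l - 13 : ℤ) : ℂ) * z / 2) (13 * z) := by
    intro n
    rw [neg_mul, ← neg_one_mul, ← Complex.exp_pi_mul_I, hp, ← Complex.exp_nat_mul,
      ← Complex.exp_nat_mul, ← Complex.exp_int_mul, jacobiTheta₂_term, jacobiTheta₂_term,
      ← Complex.exp_add, ← Complex.exp_add, ← Complex.exp_add]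
    congr 1
    push_cast
    ring
  rw [jacobiTheta₂, tsum_eq_triple_product (q := p ^ 13) (x := p ^ l) (by
    rw [norm_pow]; exact pow_lt_one₀ (norm_nonneg _) hp1 (by norm_num)) (pow_ne_zero _ hp0)
    (pow_ne_zero _ hp0) (by simp [jacobiTheta₂_term]) hT
    ((summable_jacobiTheta₂_term_iff _ _).mpr (by simpa using hz))]
  congr 2
  · ext n; congr 1; ring
  · congr 1; ext n; congr 1; ring
  · congr 1; ext n; congr 1
    rw [div_eq_iff (pow_ne_zero _ hp0), ← pow_add, ← pow_mul]
    congr 1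
    lia

theorem prod_tprod_residue_eq_tprod {f : ℕ → ℂ} (hf : Multipliable f) {m : ℕ} (hm : 0 < m)
    (hfm : ∀ l < m, Multipliable fun n => f (m * n + l)) :
    ∏ l ∈ Finset.range m, ∏' n, f (m * n + l) = ∏' n, f n := by
  have h1 : ∀ N, ∏ l ∈ Finset.range m, ∏ n ∈ Finset.range N, f (m * n + l)
      = ∏ n ∈ Finset.range (m * N), f n := by
    intro N
    induction N with
    | zero => simp
    | succ N ih =>
      rw [mul_add_one, Finset.prod_range_add, ← ih, ← Finset.prod_mul_distrib]
      simp_rw [Finset.prod_range_succ]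
  refine tendsto_nhds_unique (tendsto_finsetProd (Finset.range m) fun l hl =>
    (hfm l (Finset.mem_range.mp hl)).hasProd.tendsto_prod_nat) ?_
  simp_rw [h1]
  exact hf.hasProd.tendsto_prod_nat.comp (tendsto_id.const_mul_atTop' hm)

theorem prod_ta {z : ℂ} (hz : 0 < z.im) :
    ∏ i, ta i z = -(ModularForm.eta z * ModularForm.eta (13 * z) ^ 5) := by
  set p := Complex.exp (2 * Real.pi * I * z) with hp
  have hp1 : ‖p‖ < 1 := by
    rw [hp, Complex.norm_exp]
    simpa using by positivity
  have hres := prod_tprod_residue_eq_tprod (f := fun n => 1 - p ^ (n + 1))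
    (ModularForm.multipliable_one_sub_pow hp1) (m := 13) (by norm_num) (by
      intro l _
      convert multipliable_one_sub_pow_mul (q := p ^ 13) (y := p ^ (l + 1)) ?_ using 3
      · ring
      · rw [norm_pow]; exact pow_lt_one₀ (norm_nonneg _) hp1 (by norm_num))
  obtain ⟨F, hF⟩ : ∃ F : ℕ → ℂ, ∀ l, F l = ∏' n : ℕ, (1 - p ^ (13 * n + l)) := ⟨_, fun _ => rfl⟩
  have hth : ∀ (c : ℚ) {k : ℤ} {l l' : ℕ}, l + l' = 13 → k = 2 * l - 13 →
      th13 c k z = Complex.exp (2 * Real.pi * I * c * z) * (F 13 * (F l * F l')) := by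
    intro c k l l' hl hk
    simp only [th13_eq_jacobiTheta₂, hk, jacobiTheta₂_eq_triple_product hz hl, hF, hp]
  have hη1 : ModularForm.eta z = Complex.exp (2 * Real.pi * I * z / 24)
      * ∏' n : ℕ, (1 - p ^ (n + 1)) := by
    simp only [ModularForm.eta, Function.Periodic.qParam, ModularForm.eta_q_eq_pow, hp]
    norm_num
  have hη2 : ModularForm.eta (13 * z) = Complex.exp (2 * Real.pi * I * (13 * z) / 24)
      * F 13 := by
    simp only [hF, ModularForm.eta, Function.Periodic.qParam, ModularForm.eta_q_eq_pow, hp]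
    congr 1
    congr 1
    ext n
    rw [← Complex.exp_nat_mul, ← Complex.exp_nat_mul]
    congr 2
    push_cast
    ring
  have hexp : Complex.exp (2 * Real.pi * I * (121 / 104 : ℚ) * z)
      * Complex.exp (2 * Real.pi * I * (49 / 104 : ℚ) * z)
      * Complex.exp (2 * Real.pi * I * (25 / 104 : ℚ) * z)
      * Complex.exp (2 * Real.pi * I * (9 / 104 : ℚ) * z)
      * Complex.exp (2 * Real.pi * I * (81 / 104 : ℚ) * z)
      * Complex.exp (2 * Real.pi * I * (1 / 104 : ℚ) * z)
      = Complex.exp (2 * Real.pi * I * z / 24)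
        * Complex.exp (2 * Real.pi * I * (13 * z) / 24) ^ 5 := by
    rw [← Complex.exp_nat_mul]
    simp only [← Complex.exp_add]
    congr 1
    push_cast
    ring
  simp only [Finset.prod_range_succ, Finset.prod_range_zero, one_mul, zero_add, add_assoc,
    Nat.reduceAdd, ← hF] at hres
  simp only [ta, Fin.prod_univ_six, Matrix.cons_val]
  rw [hth _ (l := 12) (l' := 1) rfl (by norm_num), hth _ (l := 10) (l' := 3) rfl (by norm_num),
    hth _ (l := 9) (l' := 4) rfl (by norm_num), hth _ (l := 8) (l' := 5) rfl (by norm_num),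
    hth _ (l := 11) (l' := 2) rfl (by norm_num), hth _ (l := 7) (l' := 6) rfl (by norm_num),
    hη1, hη2, ← hres]
  linear_combination (-(F 1 * F 2 * F 3 * F 4 * F 5 * F 6 * F 7 * F 8 * F 9 * F 10 * F 11 * F 12
    * F 13 ^ 6)) * hexp

theorem etaF_eq_eta (z : ℂ) : etaF z = ModularForm.eta z := by
  simp only [etaF, ModularForm.eta, Function.Periodic.qParam, ModularForm.eta_q_eq_pow]
  norm_num

theorem ta_moebius {a b c d : ℤ} (h : a * d - b * c = 1)
    (ha : a ≡ 1 [ZMOD 13]) (hb : b ≡ 0 [ZMOD 13]) (hc : c ≡ 0 [ZMOD 13]) (i : Fin 6) {z : ℂ}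
    (hz : 0 < z.im) :
    ta i ((a * z + b) / (c * z + d)) * ModularForm.eta (13 * z) ^ 3 * (c * z + d)
      = ta i z * ModularForm.eta (13 * ((a * z + b) / (c * z + d))) ^ 3 := by
  have key : ∀ (r : ℚ) (k j : ℤ), r = (13 + 2 * (2 * j : ℤ)) ^ 2 / 104 → k = 13 + 2 * (2 * j) →
      th13 r k ((a * z + b) / (c * z + d)) * ModularForm.eta (13 * z) ^ 3 * (c * z + d)
        = th13 r k z * ModularForm.eta (13 * ((a * z + b) / (c * z + d))) ^ 3 := by
    rintro r k j rfl rfl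
    rw [th13_eq_oddTheta, th13_eq_oddTheta]
    exact oddTheta_moebius_level_thirteen h ha hb hc j hz
  fin_cases i <;> simp only [ta, Matrix.cons_val, Fin.zero_eta, Fin.mk_one, Fin.reduceFinMk]
  · simp only [← th13_neg _ 11]
    exact key _ _ (-6) (by norm_num) (by norm_num)
  · simp only [← th13_neg _ 7]
    exact key _ _ (-5) (by norm_num) (by norm_num)
  · exact key _ _ (-2) (by norm_num) (by norm_num)
  · simp only [← th13_neg _ 3, neg_mul, neg_inj]
    exact key _ _ (-4) (by norm_num) (by norm_num)
  · exact key _ _ (-1) (by norm_num) (by norm_num)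
  · exact key _ _ (-3) (by norm_num) (by norm_num)

end Order13

theorem stmt8 (a b c d : ℤ) (h : a * d - b * c = 1)
    (ha : a ≡ 1 [ZMOD 13]) (hd : d ≡ 1 [ZMOD 13])
    (hb : b ≡ 0 [ZMOD 13]) (hc : c ≡ 0 [ZMOD 13]) :
    ∃ u : ℂ, u ^ 3 = 1 ∧ ∀ (i : Fin 6) (z : ℂ), 0 < z.im →
      xV (((a : ℂ) * z + (b : ℂ)) / ((c : ℂ) * z + (d : ℂ))) i
        = u * ((c : ℂ) * z + (d : ℂ)) * xV z i := by
  obtain ⟨c', hc'⟩ := Int.modEq_zero_iff_dvd.mp hc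
  obtain ⟨ζ, hζ, hη⟩ := eta_pow_eight_moebius a (13 * b) c' d (by rw [← h, hc']; ring)
  refine ⟨ζ ^ 2, by rw [← pow_mul, mul_comm, pow_mul, hζ, one_pow], fun i z hz => ?_⟩
  have hz' := moebius_im_pos h hz
  have hD := moebius_denom_ne_zero h hz
  have hη13 := hη (13 * z) (by simpa using hz)
  have hta := fun i => ta_moebius h ha hb hc i hz
  have e1 : (c' : ℂ) * (13 * z) + d = c * z + d := by rw [hc']; push_cast; ring
  have e2 : (a : ℂ) * (13 * z) + (13 * b : ℤ) = 13 * (a * z + b) := by push_cast; ring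
  rw [e1, e2, mul_div_assoc] at hη13
  have hprod := Finset.prod_congr (rfl : (Finset.univ : Finset (Fin 6)) = _) fun i _ => hta i
  simp only [Finset.prod_mul_distrib, prod_ta hz, prod_ta hz', Finset.prod_const, Finset.card_univ,
    Fintype.card_fin] at hprod
  simp only [xV, etaF_eq_eta]
  have n1 : ModularForm.eta z ≠ 0 := ModularForm.eta_ne_zero hz
  have n2 : ModularForm.eta (13 * z) ≠ 0 := ModularForm.eta_ne_zero (by simpa using hz)
  have n3 : ModularForm.eta (13 * ((a * z + b) / (c * z + d))) ≠ 0 :=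
    ModularForm.eta_ne_zero (by simpa using hz')
  have hi := hta i
  generalize ModularForm.eta z = A at *
  generalize ModularForm.eta (13 * z) = B at *
  generalize ta i z = t at *
  generalize (c : ℂ) * z + d = D at *
  generalize ((a : ℂ) * z + b) / D = w at *
  generalize ModularForm.eta w = A' at *
  generalize ModularForm.eta (13 * w) = B' at *
  generalize ta i w = t' at *
  have hA : A' * B ^ 13 * D ^ 6 = A * B' ^ 13 :=
    mul_right_cancel₀ (mul_ne_zero (pow_ne_zero 5 n2) (pow_ne_zero 5 n3))
      (by linear_combination -hprod)
  refine mul_right_cancel₀ (mul_ne_zero (pow_ne_zero 16 n2) (pow_ne_zero 7 hD)) ?_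
  linear_combination t' * B ^ 3 * D * hA + A * B' ^ 13 * hi
    + A * t * (B' ^ 8 + ζ * D ^ 4 * B ^ 8) * hη13
end
end
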